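/- Let p and q be two distinct processes. Under Hypothesis 1, after p starts to broadcast a message from an arbitrary configuration (executes the starting action A1), p switches State_p[q] from 2 to 3 only if, at that moment, the following three conditions hold: (1) every message in the channel from p to q is of the form ⟨PIF, -, -, i, -⟩ with i ≠ 3; (2) NeigState_q[p] ≠ 3; (3) every message in the channel from q to p is of the form ⟨PIF, -, -, -, j⟩ with j ≠ 3. -/

import Mathlib

/-!
A formal model of Protocol PIF (Algorithm 1) in a fully-connected
message-passing system with unreliable, fair, single-message-capacity
channels.  Processes are `Fin n`; broadcast/feedback data range over `D`.

Every configuration is a possible initial configuration; an execution is an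
infinite sequence of atomic steps, each step being an external request
(`env`), an external setting of a feedback message (`setF`), one of the
actions `A1`, `A2`, `A3` of Protocol PIF, or the loss of a message in
transit.  Fairness of channels and weak fairness of enabled protocol actions
are part of the notion of execution.
-/

set_option autoImplicit false

namespace PIF

inductive Req where
  | Wait | In | Done
deriving DecidableEq

/-- A `⟨PIF, B, F, qState, pState⟩` message: the broadcast data, the feedback
data, the sender's `State[receiver]`, and the sender's `NeigState[receiver]`. -/
structure Msg (D : Type*) where
  b : D
  f : D
  sSt : Fin 5
  sNg : Fin 5

/-- A configuration: the variables of each process together with the contents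
of every channel (single-message capacity, hence `Option`).
`chan p q` is the channel from `p` to `q`. -/
structure Cfg (n : ℕ) (D : Type*) where
  req : Fin n → Req
  bmes : Fin n → D
  fmes : Fin n → Fin n → D
  st : Fin n → Fin n → Fin 5
  ng : Fin n → Fin n → Fin 5
  chan : Fin n → Fin n → Option (Msg D)

inductive Act (n : ℕ) (D : Type*) where
  /-- external request to broadcast `b`: `Request p := Wait`, `B-Mes p := b` -/
  | env (p : Fin n) (b : D)
  /-- the application externally sets the feedback message `F-Mes p [q] := f` -/
  | setF (p q : Fin n) (f : D)
  /-- action `A1` of process `p` (the starting action) -/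
  | a1 (p : Fin n)
  /-- action `A2` of process `p` (decision or (re)sending) -/
  | a2 (p : Fin n)
  /-- action `A3`: process `p` receives message `m` from process `q` -/
  | a3 (p q : Fin n) (m : Msg D)
  /-- the message in transit from `p` to `q` is lost -/
  | lose (p q : Fin n)

variable {n : ℕ} {D : Type*}

def upd2 {β : Type*} (f : Fin n → Fin n → β) (p q : Fin n) (v : β) :
    Fin n → Fin n → β :=
  fun a b => if a = p ∧ b = q then v else f a b

/-- Sending into a single-capacity unreliable channel: if the channel is full
the message is lost; if it is empty, the message is put in the channel or
lost. -/
def send (old : Option (Msg D)) (m : Msg D) (new : Option (Msg D)) : Prop :=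
  (old ≠ none ∧ new = old) ∨ (old = none ∧ (new = some m ∨ new = none))

/-- The semantics of one atomic step `γ —A→ γ'`. -/
def StepAt (γ : Cfg n D) : Act n D → Cfg n D → Prop
  | .env p b, γ' =>
      γ' = { γ with req := Function.update γ.req p .Wait,
                    bmes := Function.update γ.bmes p b }
  | .setF p q f, γ' =>
      γ' = { γ with fmes := upd2 γ.fmes p q f }
  | .a1 p, γ' =>
      γ.req p = .Wait ∧
      γ' = { γ with req := Function.update γ.req p .In,
                    st := Function.update γ.st p (fun _ => 0) }
  | .a2 p, γ' =>
      γ.req p = .In ∧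
      (((∀ q, q ≠ p → γ.st p q = 4) ∧
          γ' = { γ with req := Function.update γ.req p .Done }) ∨
       ((¬ ∀ q, q ≠ p → γ.st p q = 4) ∧
          γ'.req = γ.req ∧ γ'.bmes = γ.bmes ∧ γ'.fmes = γ.fmes ∧
          γ'.st = γ.st ∧ γ'.ng = γ.ng ∧
          (∀ q, q ≠ p → γ.st p q ≠ 4 →
            send (γ.chan p q) ⟨γ.bmes p, γ.fmes p q, γ.st p q, γ.ng p q⟩
              (γ'.chan p q)) ∧
          (∀ a b, ¬ (a = p ∧ b ≠ p ∧ γ.st p b ≠ 4) → γ'.chan a b = γ.chan a b)))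
  | .a3 p q m, γ' =>
      q ≠ p ∧ γ.chan q p = some m ∧
      (let st' : Fin 5 :=
        if γ.st p q = m.sNg ∧ (γ.st p q : ℕ) < 4 then γ.st p q + 1 else γ.st p q
       γ'.req = γ.req ∧ γ'.bmes = γ.bmes ∧ γ'.fmes = γ.fmes ∧
       γ'.st = upd2 γ.st p q st' ∧
       γ'.ng = upd2 γ.ng p q m.sSt ∧
       γ'.chan q p = none ∧
       (((m.sSt : ℕ) < 4 ∧
           send (γ.chan p q) ⟨γ.bmes p, γ.fmes p q, st', m.sSt⟩ (γ'.chan p q)) ∨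
        (¬ (m.sSt : ℕ) < 4 ∧ γ'.chan p q = γ.chan p q)) ∧
       (∀ a b, ¬ (a = q ∧ b = p) → ¬ (a = p ∧ b = q) →
          γ'.chan a b = γ.chan a b))
  | .lose p q, γ' =>
      (∃ m, γ.chan p q = some m) ∧
      γ'.req = γ.req ∧ γ'.bmes = γ.bmes ∧ γ'.fmes = γ.fmes ∧
      γ'.st = γ.st ∧ γ'.ng = γ.ng ∧
      γ'.chan p q = none ∧
      (∀ a b, ¬ (a = p ∧ b = q) → γ'.chan a b = γ.chan a b)

/-- A `receive-brd⟨B⟩ from q` event is generated at `p` in step `γ —A→ ·`. -/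
def brdEvent (γ : Cfg n D) (A : Act n D) (p q : Fin n) (B : D) : Prop :=
  ∃ m : Msg D, A = .a3 p q m ∧ m.b = B ∧ γ.ng p q ≠ 3 ∧ m.sSt = 3

/-- A `receive-fck⟨F⟩ from q` event is generated at `p` in step `γ —A→ ·`
(i.e. `State p [q]` switches from 3 to 4). -/
def fckEvent (γ : Cfg n D) (A : Act n D) (p q : Fin n) (F : D) : Prop :=
  ∃ m : Msg D, A = .a3 p q m ∧ m.f = F ∧ γ.st p q = 3 ∧ m.sNg = 3

def Enabled (γ : Cfg n D) (A : Act n D) : Prop := ∃ γ', StepAt γ A γ'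

/-- The actions of the protocol proper (weak fairness applies to these). -/
def ProcAct : Act n D → Prop
  | .a1 _ => True
  | .a2 _ => True
  | .a3 _ _ _ => True
  | _ => False

/-- Step `i` attempts to send a message from `p` to `q`. -/
def SendAttempt (γ : ℕ → Cfg n D) (act : ℕ → Act n D) (i : ℕ)
    (p q : Fin n) : Prop :=
  (act i = .a2 p ∧ (γ i).req p = .In ∧ q ≠ p ∧ (γ i).st p q ≠ 4 ∧
     ¬ ∀ r, r ≠ p → (γ i).st p r = 4) ∨
  (∃ m : Msg D, act i = .a3 p q m ∧ (m.sSt : ℕ) < 4)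

/-- An execution: an infinite sequence of valid atomic steps starting from an
arbitrary configuration, in which (weak fairness) every protocol action that
is continuously enabled is eventually executed, and (channel fairness) if
infinitely many messages are sent from `p` to `q` then `q` receives a message
from `p` infinitely often. -/
structure Exec (n : ℕ) (D : Type*) where
  γ : ℕ → Cfg n D
  act : ℕ → Act n D
  valid : ∀ i, StepAt (γ i) (act i) (γ (i + 1))
  wf : ∀ A : Act n D, ProcAct A →
        (∃ i, ∀ j, i ≤ j → Enabled (γ j) A) → ∀ i, ∃ j, i ≤ j ∧ act j = A
  chanFair : ∀ p q : Fin n, p ≠ q →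
        (∀ i, ∃ j, i ≤ j ∧ SendAttempt γ act j p q) →
        ∀ i, ∃ j, i ≤ j ∧ ∃ m : Msg D, act j = .a3 q p m

/-- Hypothesis 1: while `Request p ≠ Done`, `Request p` is not externally
set to `Wait`. -/
def Hyp1 (e : Exec n D) : Prop :=
  ∀ i p b, e.act i = .env p b → (e.γ i).req p = .Done

end PIF

namespace PIF

/-- How a channel content (projected) can evolve when its only possible new value is `v`. -/
def ChanOk (o o' : Option (Fin 5)) (v : Fin 5) : Prop :=
  o' = o ∨ o' = none ∨ o' = some v

theorem send_ok {D : Type*} {o o' : Option (Msg D)} {m : Msg D} (h : send o m o')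
    (f : Msg D → Fin 5) : ChanOk (o.map f) (o'.map f) (f m) := by
  rcases h with ⟨_, rfl⟩ | ⟨_, rfl | rfl⟩ <;> simp [ChanOk]

/-- The projection of a step on the four components relevant for the pair `(p, q)`. -/
theorem step_proj {n : ℕ} {D : Type*} {γ γ' : Cfg n D} {A : Act n D} (h : StepAt γ A γ')
    (p q : Fin n) (hpq : p ≠ q) :
    (γ'.st p q = 0) ∨
    (γ'.st p q = γ.st p q ∧ γ'.ng q p = γ.ng q p ∧
      ChanOk ((γ.chan p q).map Msg.sSt) ((γ'.chan p q).map Msg.sSt) (γ.st p q) ∧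
      ChanOk ((γ.chan q p).map Msg.sNg) ((γ'.chan q p).map Msg.sNg) (γ.ng q p)) ∨
    (∃ v, (γ.chan q p).map Msg.sNg = some v ∧ (γ'.chan q p).map Msg.sNg = none ∧
      γ'.st p q = (if γ.st p q = v ∧ (γ.st p q : ℕ) < 4 then γ.st p q + 1 else γ.st p q) ∧
      γ'.ng q p = γ.ng q p ∧
      ChanOk ((γ.chan p q).map Msg.sSt) ((γ'.chan p q).map Msg.sSt) (γ'.st p q)) ∨
    (∃ v, (γ.chan p q).map Msg.sSt = some v ∧ (γ'.chan p q).map Msg.sSt = none ∧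
      γ'.st p q = γ.st p q ∧ γ'.ng q p = v ∧
      ChanOk ((γ.chan q p).map Msg.sNg) ((γ'.chan q p).map Msg.sNg) (γ'.ng q p)) := by
  have hqp := hpq.symm
  cases A with
  | env r b => obtain rfl := h; right; left; simp [ChanOk]
  | setF r t f => obtain rfl := h; right; left; simp [ChanOk]
  | a1 r =>
    obtain ⟨_, rfl⟩ := h
    by_cases hr : p = r
    · left; simp [hr]
    · right; left; simp [ChanOk, Function.update_of_ne hr]
  | a2 r =>
    obtain ⟨_, ⟨_, rfl⟩ | ⟨_, _, _, _, hs, hn, hsend, hch⟩⟩ := h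
    · right; left; simp [ChanOk]
    · right; left
      refine ⟨by rw [hs], by rw [hn], ?_, ?_⟩
      · by_cases hc : p = r ∧ q ≠ r ∧ γ.st r q ≠ 4
        · obtain ⟨rfl, h1, h2⟩ := hc
          exact send_ok (hsend q h1 h2) Msg.sSt
        · left; rw [hch p q hc]
      · by_cases hc : q = r ∧ p ≠ r ∧ γ.st r p ≠ 4
        · obtain ⟨rfl, h1, h2⟩ := hc
          exact send_ok (hsend p h1 h2) Msg.sNg
        · left; rw [hch q p hc]
  | lose r t =>
    obtain ⟨_, _, _, _, hs, hn, hl, hch⟩ := h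
    right; left
    refine ⟨by rw [hs], by rw [hn], ?_, ?_⟩
    · by_cases hc : p = r ∧ q = t
      · obtain ⟨rfl, rfl⟩ := hc
        right; left; rw [hl]; rfl
      · left; rw [hch p q hc]
    · by_cases hc : q = r ∧ p = t
      · obtain ⟨rfl, rfl⟩ := hc
        right; left; rw [hl]; rfl
      · left; rw [hch q p hc]
  | a3 r t m =>
    obtain ⟨htr, hm, _, _, _, hs, hn, hl, hsend, hch⟩ := h
    by_cases hc : p = r ∧ q = t
    · obtain ⟨rfl, rfl⟩ := hc
      right; right; left
      refine ⟨m.sNg, by rw [hm]; rfl, by rw [hl]; rfl, by rw [hs]; simp [upd2],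
        by rw [hn]; simp [upd2, hqp], ?_⟩
      rcases hsend with ⟨_, h⟩ | ⟨_, h⟩
      · have := send_ok h Msg.sSt
        rw [hs]; simpa [upd2] using this
      · left; rw [h]
    · by_cases hd : q = r ∧ p = t
      · obtain ⟨rfl, rfl⟩ := hd
        right; right; right
        refine ⟨m.sSt, by rw [hm]; rfl, by rw [hl]; rfl, by rw [hs]; simp [upd2, hpq],
          by rw [hn]; simp [upd2], ?_⟩
        rcases hsend with ⟨_, h⟩ | ⟨_, h⟩
        · have := send_ok h Msg.sNg
          rw [hn]; simpa [upd2] using this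
        · left; rw [h]
      · right; left
        refine ⟨by rw [hs]; simp [upd2, hc], by rw [hn]; simp [upd2, hd], ?_, ?_⟩
        · left; rw [hch p q (by tauto) (by tauto)]
        · left; rw [hch q p (by tauto) (by tauto)]

/-- The invariant, on `x = State p [q]`, `y = NeigState q [p]`, and the relevant fields
`c`, `d` of the contents of the channels `p → q` and `q → p`. -/
def Inv (x y : Fin 5) (c d : Option (Fin 5)) : Prop :=
  (x = 1 → d = some 1 → y = 1 ∨ c ≠ some 3) ∧
  (x = 2 → (y = 1 ∨ c ≠ some 3) ∧ (d = some 2 → y ≠ 3 ∧ c ≠ some 3))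

/-- The invariant for a configuration. -/
def InvC {n : ℕ} {D : Type*} (p q : Fin n) (γ : Cfg n D) : Prop :=
  Inv (γ.st p q) (γ.ng q p) ((γ.chan p q).map Msg.sSt) ((γ.chan q p).map Msg.sNg)

theorem inv_step {n : ℕ} {D : Type*} {γ γ' : Cfg n D} {A : Act n D} (h : StepAt γ A γ')
    (p q : Fin n) (hpq : p ≠ q) (hi : InvC p q γ) : InvC p q γ' := by
  have hp := step_proj h p q hpq
  unfold InvC at *
  generalize γ.st p q = x at *
  generalize γ'.st p q = x' at *
  generalize γ.ng q p = y at *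
  generalize γ'.ng q p = y' at *
  generalize (γ.chan p q).map Msg.sSt = c at *
  generalize (γ'.chan p q).map Msg.sSt = c' at *
  generalize (γ.chan q p).map Msg.sNg = d at *
  generalize (γ'.chan q p).map Msg.sNg = d' at *
  unfold ChanOk at hp
  unfold Inv at *
  rcases hp with h0 | ⟨rfl, rfl, hc, hd⟩ | ⟨v, rfl, rfl, hx, rfl, hc⟩ | ⟨v, rfl, rfl, rfl, rfl, hd⟩
  · subst h0; simp
  · grind
  · refine ⟨by simp, fun h2 => ⟨?_, by simp⟩⟩
    subst h2
    have hxx : x = 2 ∨ (x = 1 ∧ v = 1) := by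
      clear hi hc h
      revert x v
      decide
    grind
  · grind

/-- Let `p` and `q` be two distinct processes.  Under
Hypothesis 1, after `p` starts to broadcast a message from an arbitrary
configuration (executes the starting action `A1` at step `s`), `p` switches
`State p [q]` from `2` to `3` (at a step `k > s`) only if, at that moment:
(1) every message in the channel from `p` to `q` is of the form
    `⟨PIF, -, -, i, -⟩` with `i ≠ 3`;
(2) `NeigState q [p] ≠ 3`;
(3) every message in the channel from `q` to `p` is of the form
    `⟨PIF, -, -, -, j⟩` with `j ≠ 3`. -/
theorem pif_switch_two_three {n : ℕ} {D : Type*}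
    (e : Exec n D) (h1 : Hyp1 e) (p q : Fin n) (hpq : p ≠ q) (s k : ℕ)
    (hstart : e.act s = .a1 p) (hsk : s < k)
    (h2 : (e.γ k).st p q = 2) (h3 : (e.γ (k + 1)).st p q = 3) :
    (∀ m : Msg D, (e.γ k).chan p q = some m → m.sSt ≠ 3) ∧
    (e.γ k).ng q p ≠ 3 ∧
    (∀ m : Msg D, (e.γ k).chan q p = some m → m.sNg ≠ 3) := by
  have inv : ∀ j, InvC p q (e.γ (s + 1 + j)) := by
    intro j
    induction j with
    | zero =>
      have hv := e.valid s
      rw [hstart] at hv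
      obtain ⟨_, hv⟩ := hv
      simp [InvC, Inv, hv]
    | succ j ih => exact inv_step (e.valid (s + 1 + j)) p q hpq ih
  obtain ⟨j, rfl⟩ := Nat.exists_eq_add_of_le (Nat.succ_le_of_lt hsk)
  have hi := inv j
  have hp := step_proj (e.valid (s + 1 + j)) p q hpq
  simp only [Nat.succ_eq_add_one] at *
  rw [h2, h3] at hp
  rcases hp with h0 | ⟨h0, _⟩ | ⟨v, hv, _, hx, _⟩ | ⟨v, _, _, h0, _⟩
  · exact absurd h0 (by decide)
  · exact absurd h0 (by decide)
  · have hv2 : v = 2 := by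
      clear hv
      revert v
      decide
    subst hv2
    obtain ⟨hy, hc⟩ := (hi.2 h2).2 hv
    refine ⟨fun m hm h => hc (by simp [hm, h]), hy, fun m hm h => ?_⟩
    rw [hm] at hv
    simp [h] at hv
  · exact absurd h0 (by decide)

end PIF
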